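/- Let p ∈ (1,∞) and δ = δ' ∈ [0,2) with d − d_H + pδ − 2p > 0, so that c_Ω = d_Γ^δ, and set C_p = (p−1)(d−d_H)(d−d_H+pδ−2p)/p². Then ∫_Ω |Hφ|^p ≥ C_p^p ∫_Ω d_Γ^{(δ−2)p} |φ|^p for all φ ∈ C_c^2(Ω). -/

import Mathlib

open MeasureTheory Set
open scoped RealInnerProductSpace

noncomputable section

/-- The Laplacian `Δφ = Σ_k ∂_k² φ`. -/
def lapl {d : ℕ} (φ : EuclideanSpace ℝ (Fin d) → ℝ) (x : EuclideanSpace ℝ (Fin d)) : ℝ :=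
  ∑ i, iteratedFDeriv ℝ 2 φ x (fun _ => EuclideanSpace.single i (1 : ℝ))

/-- The weighted operator `H = -div(d_Γ^δ ∇)` for the weight `c_Ω = d_Γ^δ`. -/
def Hop {d : ℕ} (K : Set (EuclideanSpace ℝ (Fin d))) (δ : ℝ)
    (φ : EuclideanSpace ℝ (Fin d) → ℝ) (x : EuclideanSpace ℝ (Fin d)) : ℝ :=
  -(Metric.infDist x K ^ δ) * lapl φ x -
    ⟪gradient (fun y => Metric.infDist y K ^ δ) x, gradient φ x⟫



structure IsProj {d : ℕ} (K : Set (EuclideanSpace ℝ (Fin d)))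
    (P : EuclideanSpace ℝ (Fin d) → EuclideanSpace ℝ (Fin d)) : Prop where
  mem : ∀ x, P x ∈ K
  dist : ∀ x, ‖x - P x‖ = Metric.infDist x K
  inn : ∀ x, ∀ y ∈ K, ⟪x - P x, y - P x⟫ ≤ 0

theorem exists_isProj {d : ℕ} {K : Set (EuclideanSpace ℝ (Fin d))}
    (hKne : K.Nonempty) (hKcl : IsClosed K) (hKconv : Convex ℝ K) :
    ∃ P, IsProj K P := by
  have h : ∀ x, ∃ v ∈ K, ‖x - v‖ = Metric.infDist x K ∧ ∀ y ∈ K, ⟪x - v, y - v⟫ ≤ 0 := by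
    intro x
    obtain ⟨v, hv, h⟩ := exists_norm_eq_iInf_of_complete_convex hKne hKcl.isComplete hKconv x
    refine ⟨v, hv, ?_, (norm_eq_iInf_iff_real_inner_le_zero hKconv hv).1 h⟩
    rw [h, Metric.infDist_eq_iInf]
    simp [dist_eq_norm]
  choose P h1 h2 h3 using h
  exact ⟨P, h1, h2, h3⟩

section proj
variable {d : ℕ} {K : Set (EuclideanSpace ℝ (Fin d))}
  {P : EuclideanSpace ℝ (Fin d) → EuclideanSpace ℝ (Fin d)}

theorem IsProj.mono (h : IsProj K P) (x y : EuclideanSpace ℝ (Fin d)) :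
    ‖P x - P y‖ ^ 2 ≤ ⟪x - y, P x - P y⟫ := by
  have h1 := h.inn x (P y) (h.mem y)
  have h2 := h.inn y (P x) (h.mem x)
  rw [← real_inner_self_eq_norm_sq]
  simp only [inner_sub_left, inner_sub_right] at *
  linarith [real_inner_comm (P x) (P y)]

theorem IsProj.lip (h : IsProj K P) : LipschitzWith 1 P := by
  refine LipschitzWith.of_dist_le_mul fun x y => ?_
  rw [dist_eq_norm, dist_eq_norm, NNReal.coe_one, one_mul]
  have h1 := h.mono x y
  have h2 := real_inner_le_norm (x - y) (P x - P y)
  by_contra! hc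
  nlinarith [norm_nonneg (x - y), norm_nonneg (P x - P y)]

theorem IsProj.eq_of (h : IsProj K P) {x v : EuclideanSpace ℝ (Fin d)} (hv : v ∈ K)
    (hi : ∀ y ∈ K, ⟪x - v, y - v⟫ ≤ 0) : P x = v := by
  have h1 := h.inn x v hv
  have h2 := hi (P x) (h.mem x)
  have h3 : ‖P x - v‖ ^ 2 ≤ 0 := by
    rw [← real_inner_self_eq_norm_sq]
    simp only [inner_sub_left, inner_sub_right] at *
    linarith [real_inner_comm (P x) v]
  have : ‖P x - v‖ = 0 := by nlinarith [norm_nonneg (P x - v)]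
  exact sub_eq_zero.1 (norm_eq_zero.1 this)

theorem IsProj.ray (h : IsProj K P) (x : EuclideanSpace ℝ (Fin d)) {t : ℝ} (ht : -1 ≤ t) :
    P (x + t • (x - P x)) = P x := by
  refine h.eq_of (h.mem x) fun y hy => ?_
  have : x + t • (x - P x) - P x = (1 + t) • (x - P x) := by module
  rw [this, real_inner_smul_left]
  exact mul_nonpos_of_nonneg_of_nonpos (by linarith) (h.inn x y hy)

theorem IsProj.hasFDerivAt_sq (h : IsProj K P) (x : EuclideanSpace ℝ (Fin d)) :
    HasFDerivAt (fun y => Metric.infDist y K ^ 2) ((2 : ℝ) • innerSL ℝ (x - P x)) x := by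
  have key : ∀ y, |Metric.infDist y K ^ 2 - Metric.infDist x K ^ 2 - 2 * ⟪x - P x, y - x⟫|
      ≤ ‖y - x‖ ^ 2 := by
    have up : ∀ x y, Metric.infDist y K ^ 2 ≤ Metric.infDist x K ^ 2 + 2 * ⟪x - P x, y - x⟫
        + ‖y - x‖ ^ 2 := by
      intro x y
      have h1 : Metric.infDist y K ≤ ‖y - P x‖ := by
        rw [← dist_eq_norm]; exact Metric.infDist_le_dist_of_mem (h.mem x)
      have h2 : Metric.infDist y K ^ 2 ≤ ‖y - P x‖ ^ 2 := by
        gcongr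
        exact Metric.infDist_nonneg
      have h3 : y - P x = (x - P x) + (y - x) := by abel
      rw [h3, norm_add_sq_real, h.dist x] at h2
      linarith
    intro y
    have h1 := up x y
    have h2 := up y x
    have h3 := h.mono x y
    have h4 : ‖P x - P y‖ ≤ ‖x - y‖ := by simpa [dist_eq_norm] using h.lip.dist_le_mul x y
    have h5 := real_inner_le_norm (x - y) (P x - P y)
    have h6 : ⟪x - y, P x - P y⟫ ≤ ‖x - y‖ ^ 2 := by nlinarith [norm_nonneg (x - y)]
    rw [norm_sub_rev x y] at h2 h6
    have h7 : ⟪y - P y, x - y⟫ = - ⟪x - P x, y - x⟫ - ‖y - x‖ ^ 2 + ⟪x - y, P x - P y⟫ := by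
      rw [← real_inner_self_eq_norm_sq]
      simp only [inner_sub_left, inner_sub_right]
      linarith [real_inner_comm (P x) x, real_inner_comm (P x) y, real_inner_comm (P y) x,
        real_inner_comm (P y) y, real_inner_comm x y]
    rw [abs_le]
    constructor <;> nlinarith
  rw [hasFDerivAt_iff_isLittleO_nhds_zero]
  have hb : (fun v : EuclideanSpace ℝ (Fin d) => Metric.infDist (x + v) K ^ 2
      - Metric.infDist x K ^ 2 - ((2 : ℝ) • innerSL ℝ (x - P x)) v) =O[nhds 0]
      fun v => ‖v‖ ^ 2 := by
    refine Asymptotics.IsBigO.of_bound 1 (Filter.Eventually.of_forall fun v => ?_)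
    have := key (x + v)
    simpa [inner_sub_left] using this
  exact hb.trans_isLittleO (Asymptotics.isLittleO_norm_pow_id one_lt_two)

theorem IsProj.pos (hKne : K.Nonempty) (hKcl : IsClosed K)
    {x : EuclideanSpace ℝ (Fin d)} (hx : x ∈ Kᶜ) : 0 < Metric.infDist x K :=
  (hKcl.notMem_iff_infDist_pos hKne).1 hx

theorem IsProj.hasFDerivAt_rpow (h : IsProj K P) (e : ℝ) {x : EuclideanSpace ℝ (Fin d)}
    (hx : 0 < Metric.infDist x K) :
    HasFDerivAt (fun y => Metric.infDist y K ^ e)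
      ((e * Metric.infDist x K ^ (e - 2)) • innerSL ℝ (x - P x)) x := by
  have h1 := (h.hasFDerivAt_sq x).rpow_const (p := e / 2) (Or.inl (by positivity))
  have h2 : (fun y => (Metric.infDist y K ^ 2) ^ (e / 2)) = fun y => Metric.infDist y K ^ e := by
    funext y
    rw [← Real.rpow_natCast, ← Real.rpow_mul Metric.infDist_nonneg]
    congr 1; push_cast; ring
  rw [h2] at h1
  refine h1.congr_fderiv ?_
  rw [smul_smul, ← Real.rpow_natCast, ← Real.rpow_mul hx.le]
  congr 1
  have : ((2 : ℕ) : ℝ) * (e / 2 - 1) = e - 2 := by push_cast; ring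
  rw [this]; ring

theorem IsProj.continuousOn_rpow (hKne : K.Nonempty) (hKcl : IsClosed K) (e : ℝ) :
    ContinuousOn (fun y => Metric.infDist y K ^ e) Kᶜ := by
  refine ContinuousOn.rpow_const (Metric.continuous_infDist_pt K).continuousOn fun x hx => ?_
  exact Or.inl (IsProj.pos hKne hKcl hx).ne'

theorem IsProj.contDiffOn_rpow (h : IsProj K P) (hKne : K.Nonempty) (hKcl : IsClosed K) (e : ℝ) :
    ContDiffOn ℝ 1 (fun y => Metric.infDist y K ^ e) Kᶜ := by
  have : (1 : WithTop ℕ∞) = 0 + 1 := by simp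
  rw [this, contDiffOn_succ_iff_fderiv_of_isOpen hKcl.isOpen_compl]
  refine ⟨fun x hx => (h.hasFDerivAt_rpow e
    (IsProj.pos hKne hKcl hx)).differentiableAt.differentiableWithinAt, by simp, ?_⟩
  rw [contDiffOn_zero]
  have hc : ContinuousOn (fun x => (e * Metric.infDist x K ^ (e - 2)) •
      innerSL ℝ (x - P x)) Kᶜ := by
    refine ContinuousOn.smul (continuousOn_const.mul (IsProj.continuousOn_rpow hKne hKcl _)) ?_
    have := h.lip.continuous
    exact (by fun_prop : Continuous fun x => innerSL ℝ (x - P x)).continuousOn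
  exact hc.congr fun x hx => (h.hasFDerivAt_rpow e (IsProj.pos hKne hKcl hx)).fderiv

/-- trace bound -/
theorem trace_le_finrank (T : EuclideanSpace ℝ (Fin d) →L[ℝ] EuclideanSpace ℝ (Fin d))
    (W : Submodule ℝ (EuclideanSpace ℝ (Fin d)))
    (h1 : ∀ v, ⟪v, T v⟫ ≤ ‖v‖ ^ 2) (h2 : ∀ v ∈ Wᗮ, ⟪v, T v⟫ ≤ 0) :
    ∑ i, (T (EuclideanSpace.single i 1)) i ≤ Module.finrank ℝ W := by
  have e1 : ∑ i, (T (EuclideanSpace.single i 1)) i = LinearMap.trace ℝ _ T.toLinearMap := by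
    rw [LinearMap.trace_eq_sum_inner _ (EuclideanSpace.basisFun (Fin d) ℝ)]
    refine Finset.sum_congr rfl fun i _ => ?_
    simp [EuclideanSpace.inner_single_left]
  let b := ((stdOrthonormalBasis ℝ W).prod (stdOrthonormalBasis ℝ Wᗮ)).map
    W.orthogonalDecomposition.symm
  rw [e1, LinearMap.trace_eq_sum_inner _ b, Fintype.sum_sum_type]
  have hb1 : ∀ i, ⟪b (Sum.inl i), T.toLinearMap (b (Sum.inl i))⟫ ≤ 1 := fun i => by
    simpa using h1 (b (Sum.inl i))
  have hb2 : ∀ i, ⟪b (Sum.inr i), T.toLinearMap (b (Sum.inr i))⟫ ≤ 0 := fun i => by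
    apply h2
    have : b (Sum.inr i) = (stdOrthonormalBasis ℝ Wᗮ) i := by
      simp only [b, OrthonormalBasis.map_apply]
      rw [LinearIsometryEquiv.symm_apply_eq, Submodule.orthogonalDecomposition_apply]
      have hz : W.orthogonalProjectionOnto ((stdOrthonormalBasis ℝ Wᗮ) i :
          EuclideanSpace ℝ (Fin d)) = 0 :=
        Submodule.orthogonalProjectionOnto_eq_zero_iff.2 (Subtype.mem _)
      simp [hz]
    rw [this]
    exact Subtype.mem _
  have s1 := Finset.sum_le_sum fun i (_ : i ∈ Finset.univ) => hb1 i
  have s2 := Finset.sum_le_sum fun i (_ : i ∈ Finset.univ) => hb2 i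
  simp at s1 s2
  simp
  linarith

theorem IsProj.trace_le (h : IsProj K P) (hd : 1 ≤ d) {x : EuclideanSpace ℝ (Fin d)}
    (hx : 0 < Metric.infDist x K) {T : EuclideanSpace ℝ (Fin d) →L[ℝ] EuclideanSpace ℝ (Fin d)}
    (hT : HasFDerivAt P T x) :
    ∑ i, (T (EuclideanSpace.single i 1)) i ≤
      ((min (Module.finrank ℝ (affineSpan ℝ K).direction) (d - 1) : ℕ) : ℝ) := by
  have hn : ‖T‖ ≤ 1 := by simpa using hT.le_of_lipschitz h.lip
  have h1 : ∀ v, ⟪v, T v⟫ ≤ ‖v‖ ^ 2 := fun v => by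
    have a := real_inner_le_norm v (T v)
    have b : ‖T v‖ ≤ 1 * ‖v‖ := T.le_of_opNorm_le hn v
    nlinarith [norm_nonneg v]
  rw [Nat.cast_min]
  refine le_min ?_ ?_
  · refine trace_le_finrank T _ h1 fun v hv => le_of_eq ?_
    -- ⟪v, P (x + t v)⟫ is constant
    have h3 : HasFDerivAt (fun y => ⟪v, P y⟫) ((innerSL ℝ v).comp T) x :=
      (innerSL ℝ v).hasFDerivAt.comp x hT
    have h4 : (fun y => ⟪v, P y⟫) = fun y => ⟪v, P x⟫ := by
      funext y
      have : P y - P x ∈ (affineSpan ℝ K).direction :=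
        AffineSubspace.vsub_mem_direction (subset_affineSpan ℝ K (h.mem y))
          (subset_affineSpan ℝ K (h.mem x))
      have h5 := Submodule.inner_left_of_mem_orthogonal this hv
      rw [inner_sub_right] at h5
      linarith
    rw [h4] at h3
    have := h3.unique (hasFDerivAt_const _ _)
    simpa using congrArg (fun L => L v) this
  · have hu : x - P x ≠ 0 := by
      rw [← norm_pos_iff, h.dist]; exact hx
    have hz : T (x - P x) = 0 := by
      have h3 := hT.hasLineDerivAt (x - P x)
      have h4 : (fun t : ℝ => P (x + t • (x - P x))) =ᶠ[nhds 0] fun _ => P x := by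
        filter_upwards [Ici_mem_nhds (show (-1 : ℝ) < 0 by norm_num)] with t ht
        exact h.ray x ht
      exact HasDerivAt.unique h3 ((hasDerivAt_const (0 : ℝ) (P x)).congr_of_eventuallyEq h4)
    have hle := trace_le_finrank T (ℝ ∙ (x - P x))ᗮ h1 fun v hv => by
      rw [Submodule.orthogonal_orthogonal, Submodule.mem_span_singleton] at hv
      obtain ⟨c, rfl⟩ := hv
      simp [hz]
    have hf : Module.finrank ℝ (ℝ ∙ (x - P x))ᗮ = d - 1 := by
      have := (ℝ ∙ (x - P x)).finrank_add_finrank_orthogonal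
      rw [finrank_span_singleton hu, finrank_euclideanSpace_fin] at this
      omega
    rwa [hf] at hle

end proj


/-- coordinate functional -/
abbrev coordL (d : ℕ) (i : Fin d) : EuclideanSpace ℝ (Fin d) →L[ℝ] ℝ := EuclideanSpace.proj i

section weak
variable {d : ℕ} {K : Set (EuclideanSpace ℝ (Fin d))}
  {P : EuclideanSpace ℝ (Fin d) → EuclideanSpace ℝ (Fin d)}

theorem sum_fderiv_coord (L : EuclideanSpace ℝ (Fin d) →L[ℝ] ℝ) (u : EuclideanSpace ℝ (Fin d)) :
    ∑ i, L (EuclideanSpace.single i 1) * u i = L u := by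
  conv_rhs => rw [← (EuclideanSpace.basisFun (Fin d) ℝ).sum_repr u]
  simp [mul_comm]

theorem integral_fderiv_zero {f : EuclideanSpace ℝ (Fin d) → ℝ} (hf : ContDiff ℝ 1 f)
    (hc : HasCompactSupport f) (v : EuclideanSpace ℝ (Fin d)) : ∫ x, fderiv ℝ f x v = 0 := by
  obtain ⟨D, hD⟩ := hf.lipschitzWith_of_hasCompactSupport hc (by simp)
  have h := (LipschitzWith.const (1 : ℝ)).integral_lineDeriv_mul_eq
    (μ := (volume : Measure (EuclideanSpace ℝ (Fin d)))) hD hc (-v)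
  simp only [neg_neg, mul_one] at h
  have h0 : ∀ x, lineDeriv ℝ (fun _ : EuclideanSpace ℝ (Fin d) => (1 : ℝ)) x (-v) = 0 := by
    intro x; simp [lineDeriv]
  simp only [h0, zero_mul, integral_zero] at h
  rw [h]
  refine integral_congr_ae (Filter.Eventually.of_forall fun x => ?_)
  exact ((hf.differentiable (by simp) x).lineDeriv_eq_fderiv).symm

theorem integrable_fderiv_mul {f g : EuclideanSpace ℝ (Fin d) → ℝ} (hf : ContDiff ℝ 1 f)
    (hc : HasCompactSupport f) (hg : Continuous g) (v : EuclideanSpace ℝ (Fin d)) :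
    Integrable fun x => fderiv ℝ f x v * g x := by
  refine Continuous.integrable_of_hasCompactSupport ?_ ?_
  · exact ((hf.continuous_fderiv (by simp)).clm_apply continuous_const).mul hg
  · exact (hc.fderiv_apply ℝ v).mul_right

theorem integral_div_zero {h φ : EuclideanSpace ℝ (Fin d) → ℝ} (hh : ContDiff ℝ 1 h)
    (hc : HasCompactSupport h) (hφ : ContDiff ℝ 2 φ) :
    Integrable (fun x => fderiv ℝ h x (gradient φ x) + h x * lapl φ x) ∧
    ∫ x, (fderiv ℝ h x (gradient φ x) + h x * lapl φ x) = 0 := by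
  have hφ1 : ∀ v, ContDiff ℝ 1 fun x => fderiv ℝ φ x v := fun v =>
    (hφ.fderiv_right (m := 1) (by norm_num)).clm_apply contDiff_const
  let f : Fin d → EuclideanSpace ℝ (Fin d) → ℝ := fun i x =>
    h x * fderiv ℝ φ x (EuclideanSpace.single i 1)
  have hf : ∀ i, ContDiff ℝ 1 (f i) := fun i => hh.mul (hφ1 _)
  have hfc : ∀ i, HasCompactSupport (f i) := fun i => hc.mul_right
  have e : (fun x => fderiv ℝ h x (gradient φ x) + h x * lapl φ x) =
      fun x => ∑ i, fderiv ℝ (f i) x (EuclideanSpace.single i 1) := by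
    funext x
    rw [← sum_fderiv_coord, lapl, Finset.mul_sum, ← Finset.sum_add_distrib]
    refine Finset.sum_congr rfl fun i _ => ?_
    have hd1 : DifferentiableAt ℝ (fun x => fderiv ℝ φ x) x :=
      (hφ.fderiv_right (m := 1) (by norm_num)).differentiable (by simp) x
    have h1 : fderiv ℝ (f i) x = h x • fderiv ℝ (fun x => fderiv ℝ φ x
        (EuclideanSpace.single i 1)) x + fderiv ℝ φ x (EuclideanSpace.single i 1) • fderiv ℝ h x :=
      fderiv_fun_mul (hh.differentiable (by simp) x) ((hφ1 _).differentiable (by simp) x)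
    have h2 : fderiv ℝ (fun x => fderiv ℝ φ x (EuclideanSpace.single i 1)) x
        (EuclideanSpace.single i 1) = iteratedFDeriv ℝ 2 φ x
          (fun _ => EuclideanSpace.single i (1 : ℝ)) := by
      rw [iteratedFDeriv_two_apply, fderiv_clm_apply hd1 (differentiableAt_const _)]
      simp
    have h3 : (gradient φ x) i = fderiv ℝ φ x (EuclideanSpace.single i 1) := by
      have : ⟪gradient φ x, EuclideanSpace.single i 1⟫
          = fderiv ℝ φ x (EuclideanSpace.single i 1) := by
        rw [gradient, InnerProductSpace.toDual_symm_apply]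
      rw [← this, EuclideanSpace.inner_single_right]
      simp
    rw [h1, h3, ← h2]
    simp only [add_apply, smul_apply, smul_eq_mul]
    ring
  have hint : ∀ i, Integrable fun x => fderiv ℝ (f i) x (EuclideanSpace.single i 1) := fun i => by
    simpa using integrable_fderiv_mul (hf i) (hfc i) (continuous_const (y := (1 : ℝ)))
      (EuclideanSpace.single i 1)
  rw [e]
  refine ⟨integrable_finsetSum _ fun i _ => hint i, ?_⟩
  rw [integral_finsetSum _ fun i _ => hint i]
  exact Finset.sum_eq_zero fun i _ => integral_fderiv_zero (hf i) (hfc i) _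

theorem IsProj.weak (h : IsProj K P) (hd : 1 ≤ d) (hKne : K.Nonempty) (hKcl : IsClosed K)
    {ψ : EuclideanSpace ℝ (Fin d) → ℝ} (hψ : ContDiff ℝ 1 ψ) (hc : HasCompactSupport ψ)
    (hs : tsupport ψ ⊆ Kᶜ) (h0 : ∀ x, 0 ≤ ψ x) :
    Integrable (fun x => - fderiv ℝ ψ x (x - P x) - ((d : ℝ) -
      ((min (Module.finrank ℝ (affineSpan ℝ K).direction) (d - 1) : ℕ) : ℝ)) * ψ x) ∧
    0 ≤ ∫ x, (- fderiv ℝ ψ x (x - P x) - ((d : ℝ) -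
      ((min (Module.finrank ℝ (affineSpan ℝ K).direction) (d - 1) : ℕ) : ℝ)) * ψ x) := by
  set N : ℝ := (d : ℝ) -
      ((min (Module.finrank ℝ (affineSpan ℝ K).direction) (d - 1) : ℕ) : ℝ) with hN
  obtain ⟨D, hD⟩ := hψ.lipschitzWith_of_hasCompactSupport hc (by simp)
  have hu : LipschitzWith (1 + 1) fun x => x - P x := LipschitzWith.id.sub h.lip
  have hui : ∀ i : Fin d, LipschitzWith (‖coordL d i‖₊
      * (1 + 1)) fun x => (x - P x) i := fun i =>
    (coordL d i).lipschitz.comp hu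
  have hib := fun i : Fin d => (hui i).integral_lineDeriv_mul_eq
    (μ := (volume : Measure (EuclideanSpace ℝ (Fin d)))) hD hc (EuclideanSpace.single i 1)
  have hψi : Integrable ψ := hψ.continuous.integrable_of_hasCompactSupport hc
  have hint1 : ∀ i : Fin d, Integrable fun x =>
      fderiv ℝ ψ x (EuclideanSpace.single i 1) * (x - P x) i := fun i =>
    integrable_fderiv_mul hψ hc (hui i).continuous _
  have e1 : ∀ x, fderiv ℝ ψ x (x - P x) =
      ∑ i, fderiv ℝ ψ x (EuclideanSpace.single i 1) * (x - P x) i :=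
    fun x => (sum_fderiv_coord _ _).symm
  have hintd : Integrable fun x => fderiv ℝ ψ x (x - P x) := by
    simp only [e1]
    exact integrable_finsetSum _ fun i _ => hint1 i
  have hint2 : ∀ i : Fin d, Integrable fun x =>
      lineDeriv ℝ (fun x => (x - P x) i) x (EuclideanSpace.single i 1) * ψ x := fun i => by
    have := (hui i).memLp_lineDeriv (μ := (volume : Measure (EuclideanSpace ℝ (Fin d))))
      (EuclideanSpace.single i 1)
    exact hψi.mul_of_top_right this
  have hneg : Integrable fun x => - fderiv ℝ ψ x (x - P x) := hintd.neg
  refine ⟨hneg.sub (hψi.const_mul _), ?_⟩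
  rw [integral_sub hneg (hψi.const_mul _), sub_nonneg]
  have e2 : ∫ x, - fderiv ℝ ψ x (x - P x) = ∫ x, ∑ i,
      lineDeriv ℝ (fun x => (x - P x) i) x (EuclideanSpace.single i 1) * ψ x := by
    rw [integral_neg, integral_finsetSum _ fun i _ => hint2 i]
    simp only [e1]
    rw [integral_finsetSum _ fun i _ => hint1 i, ← Finset.sum_neg_distrib]
    refine Finset.sum_congr rfl fun i _ => ?_
    rw [hib i, ← integral_neg]
    refine integral_congr_ae (Filter.Eventually.of_forall fun x => ?_)
    simp only
    rw [(hψ.differentiable (by simp) x).lineDeriv_eq_fderiv]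
    simp
  rw [e2]
  refine integral_mono_ae (hψi.const_mul _) (integrable_finsetSum _ fun i _ => hint2 i) ?_
  filter_upwards [h.lip.ae_differentiableAt] with x hx
  by_cases hxK : x ∈ Kᶜ
  · rw [← Finset.sum_mul]
    refine mul_le_mul_of_nonneg_right ?_ (h0 x)
    have htr := h.trace_le hd (IsProj.pos hKne hKcl hxK) hx.hasFDerivAt
    have e3 : ∀ i : Fin d, lineDeriv ℝ (fun x => (x - P x) i) x (EuclideanSpace.single i 1)
        = 1 - (fderiv ℝ P x (EuclideanSpace.single i 1)) i := by
      intro i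
      have h1 : HasFDerivAt (fun x => x - P x) (ContinuousLinearMap.id ℝ _ - fderiv ℝ P x) x :=
        (hasFDerivAt_id x).sub hx.hasFDerivAt
      have h2 : HasFDerivAt (fun x => (x - P x) i) ((coordL d i).comp (ContinuousLinearMap.id ℝ _ - fderiv ℝ P x)) x :=
        (coordL d i).hasFDerivAt.comp x h1
      rw [(h2.hasLineDerivAt _).lineDeriv]
      simp [coordL]
    simp only [e3, Finset.sum_sub_distrib]
    simp
    rw [hN]
    linarith
  · have : ψ x = 0 := image_eq_zero_of_notMem_tsupport fun hx => hxK (hs hx)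
    simp [this]

theorem contDiff_mul_of_tsupport {f g : EuclideanSpace ℝ (Fin d) → ℝ} {U S : Set _}
    (hU : IsOpen U) (hf : ContDiffOn ℝ 1 f U) (hg : ContDiff ℝ 1 g) (hS : IsClosed S)
    (hSU : S ⊆ U) (hgS : ∀ x ∉ S, g x = 0) : ContDiff ℝ 1 fun x => f x * g x := by
  rw [contDiff_iff_contDiffAt]
  intro x
  by_cases hx : x ∈ S
  · exact (hf.contDiffAt (hU.mem_nhds (hSU hx))).mul hg.contDiffAt
  · refine contDiffAt_const (c := (0 : ℝ)).congr_of_eventuallyEq ?_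
    filter_upwards [hS.isOpen_compl.mem_nhds hx] with y hy
    simp [hgS y hy]

end weak


section core
variable {d : ℕ} {K : Set (EuclideanSpace ℝ (Fin d))}
  {P : EuclideanSpace ℝ (Fin d) → EuclideanSpace ℝ (Fin d)}

theorem IsProj.gradient_rpow (h : IsProj K P) (e : ℝ) {x : EuclideanSpace ℝ (Fin d)}
    (hx : 0 < Metric.infDist x K) (v : EuclideanSpace ℝ (Fin d)) :
    ⟪gradient (fun y => Metric.infDist y K ^ e) x, v⟫ =
      e * Metric.infDist x K ^ (e - 2) * ⟪x - P x, v⟫ := by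
  rw [gradient, InnerProductSpace.toDual_symm_apply, (h.hasFDerivAt_rpow e hx).fderiv]
  simp only [smul_apply, smul_eq_mul, innerSL_apply_apply]

theorem inner_gradient (φ : EuclideanSpace ℝ (Fin d) → ℝ) (x v : EuclideanSpace ℝ (Fin d)) :
    fderiv ℝ φ x v = ⟪v, gradient φ x⟫ := by
  rw [real_inner_comm, gradient, InnerProductSpace.toDual_symm_apply]

theorem continuous_gradient {φ : EuclideanSpace ℝ (Fin d) → ℝ} (hφ : ContDiff ℝ 2 φ) :
    Continuous (gradient φ) := by
  unfold gradient
  exact (LinearIsometryEquiv.continuous _).comp (hφ.continuous_fderiv (by norm_num))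

theorem continuous_lapl {φ : EuclideanSpace ℝ (Fin d) → ℝ} (hφ : ContDiff ℝ 2 φ) :
    Continuous (lapl φ) := by
  unfold lapl
  refine continuous_finsetSum _ fun i _ => ?_
  have := hφ.continuous_iteratedFDeriv (m := 2) le_rfl
  fun_prop

theorem IsProj.Hop_eq (h : IsProj K P) (δ : ℝ) (φ : EuclideanSpace ℝ (Fin d) → ℝ)
    {x : EuclideanSpace ℝ (Fin d)} (hx : 0 < Metric.infDist x K) :
    Hop K δ φ x = -(Metric.infDist x K ^ δ) * lapl φ x -
      δ * Metric.infDist x K ^ (δ - 2) * ⟪x - P x, gradient φ x⟫ := by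
  rw [Hop, h.gradient_rpow δ hx]

theorem IsProj.continuousOn_Hop (h : IsProj K P) (hKne : K.Nonempty) (hKcl : IsClosed K)
    (δ : ℝ) {φ : EuclideanSpace ℝ (Fin d) → ℝ} (hφ : ContDiff ℝ 2 φ) :
    ContinuousOn (Hop K δ φ) Kᶜ := by
  have h1 := continuous_gradient hφ
  have h2 := continuous_lapl hφ
  have h3 := h.lip.continuous
  have h4 : Continuous fun x => ⟪x - P x, gradient φ x⟫ := by fun_prop
  refine ContinuousOn.congr (f := fun x => -(Metric.infDist x K ^ δ) * lapl φ x -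
      δ * Metric.infDist x K ^ (δ - 2) * ⟪x - P x, gradient φ x⟫) ?_
    fun x hx => h.Hop_eq δ φ (IsProj.pos hKne hKcl hx)
  exact ((IsProj.continuousOn_rpow hKne hKcl δ).neg.mul h2.continuousOn).sub
    ((continuousOn_const.mul (IsProj.continuousOn_rpow hKne hKcl _)).mul h4.continuousOn)

theorem lapl_zero {φ : EuclideanSpace ℝ (Fin d) → ℝ} {x : EuclideanSpace ℝ (Fin d)}
    (hx : x ∉ tsupport φ) : lapl φ x = 0 := by
  unfold lapl
  have : iteratedFDeriv ℝ 2 φ x = 0 :=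
    image_eq_zero_of_notMem_tsupport fun h => hx (tsupport_iteratedFDeriv_subset (𝕜 := ℝ) 2 h)
  simp [this]

theorem gradient_zero {φ : EuclideanSpace ℝ (Fin d) → ℝ} {x : EuclideanSpace ℝ (Fin d)}
    (hx : x ∉ tsupport φ) : gradient φ x = 0 := by
  unfold gradient
  have : fderiv ℝ φ x = 0 :=
    image_eq_zero_of_notMem_tsupport fun h => hx (tsupport_fderiv_subset ℝ h)
  simp [this]

theorem Hop_zero {δ : ℝ} {φ : EuclideanSpace ℝ (Fin d) → ℝ} {x : EuclideanSpace ℝ (Fin d)}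
    (hx : x ∉ tsupport φ) : Hop K δ φ x = 0 := by
  simp [Hop, lapl_zero hx, gradient_zero hx]

theorem core_ineq (h : IsProj K P) (hd : 1 ≤ d) (hKne : K.Nonempty) (hKcl : IsClosed K)
    {p δ s N m k : ℝ}
    (hN : N = (d : ℝ) -
      ((min (Module.finrank ℝ (affineSpan ℝ K).direction) (d - 1) : ℕ) : ℝ))
    (hm : m = (δ - 2) * p) (hk : k = 2 * s + (2 - δ) * (p - 1)) (hk0 : 0 ≤ k)
    {φ : EuclideanSpace ℝ (Fin d) → ℝ} (hφ : ContDiff ℝ 2 φ)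
    (hφc : HasCompactSupport φ) (hφs : tsupport φ ⊆ Kᶜ)
    {F F' G : ℝ → ℝ} (hF : ∀ t, HasDerivAt F (F' t) t) (hG : ∀ t, HasDerivAt G (F t) t)
    (hF'c : Continuous F') (hF0 : F 0 = 0) (hG0 : G 0 = 0) (hGn : ∀ t, 0 ≤ G t)
    (hF' : ∀ t, 0 < F' t) :
    IntegrableOn (fun x => Hop K δ φ x * F (φ x) * Metric.infDist x K ^ (m + 2 - δ)
      - k * (N + m) * (Metric.infDist x K ^ m * G (φ x))
      + s ^ 2 * (Metric.infDist x K ^ m * (F (φ x) ^ 2 / F' (φ x)))) (tsupport φ) ∧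
    0 ≤ ∫ x in tsupport φ, (Hop K δ φ x * F (φ x) * Metric.infDist x K ^ (m + 2 - δ)
      - k * (N + m) * (Metric.infDist x K ^ m * G (φ x))
      + s ^ 2 * (Metric.infDist x K ^ m * (F (φ x) ^ 2 / F' (φ x)))) := by
  have hFc : Continuous F := continuous_iff_continuousAt.2 fun t => (hF t).continuousAt
  have hGc : Continuous G := continuous_iff_continuousAt.2 fun t => (hG t).continuousAt
  have hF1 : ContDiff ℝ 1 F := by
    rw [contDiff_one_iff_deriv]
    refine ⟨fun t => (hF t).differentiableAt, ?_⟩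
    rwa [show deriv F = F' from funext fun t => (hF t).deriv]
  have hG1 : ContDiff ℝ 1 G := by
    rw [contDiff_one_iff_deriv]
    refine ⟨fun t => (hG t).differentiableAt, ?_⟩
    rwa [show deriv G = F from funext fun t => (hG t).deriv]
  have hφ1 : ContDiff ℝ 1 φ := hφ.of_le (by norm_num)
  have hφ0 : ∀ x ∉ tsupport φ, φ x = 0 := fun x hx => image_eq_zero_of_notMem_tsupport hx
  set S := tsupport φ with hS
  have hScl : IsClosed S := isClosed_tsupport φ
  have hSc : IsCompact S := hφc
  have hU := hKcl.isOpen_compl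
  let hh : EuclideanSpace ℝ (Fin d) → ℝ := fun x => Metric.infDist x K ^ (m + 2) * F (φ x)
  let ψ : EuclideanSpace ℝ (Fin d) → ℝ := fun x => Metric.infDist x K ^ m * G (φ x)
  have hh1 : ContDiff ℝ 1 hh := contDiff_mul_of_tsupport hU (h.contDiffOn_rpow hKne hKcl _)
    (hF1.comp hφ1) hScl hφs fun x hx => by simp [hφ0 x hx, hF0]
  have hψ1 : ContDiff ℝ 1 ψ := contDiff_mul_of_tsupport hU (h.contDiffOn_rpow hKne hKcl _)
    (hG1.comp hφ1) hScl hφs fun x hx => by simp [hφ0 x hx, hG0]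
  have hh0 : ∀ x ∉ S, hh x = 0 := fun x hx => by simp [hh, hφ0 x hx, hF0]
  have hψ0 : ∀ x ∉ S, ψ x = 0 := fun x hx => by simp [ψ, hφ0 x hx, hG0]
  have hhc : HasCompactSupport hh := HasCompactSupport.intro hSc hh0
  have hψc : HasCompactSupport ψ := HasCompactSupport.intro hSc hψ0
  have hψS : tsupport ψ ⊆ S := closure_minimal (fun x hx => by
    by_contra hc; exact hx (hψ0 x hc)) hScl
  have hhS : tsupport hh ⊆ S := closure_minimal (fun x hx => by
    by_contra hc; exact hx (hh0 x hc)) hScl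
  have hψn : ∀ x, 0 ≤ ψ x := fun x =>
    mul_nonneg (Real.rpow_nonneg Metric.infDist_nonneg _) (hGn _)
  obtain ⟨i1, z1⟩ := integral_div_zero hh1 hhc hφ
  obtain ⟨i2, z2⟩ := h.weak hd hKne hKcl hψ1 hψc (hψS.trans hφs) hψn
  rw [← hN] at i2 z2
  have key : 0 ≤ ∫ x, (-(fderiv ℝ hh x (gradient φ x) + hh x * lapl φ x) +
      k * (- fderiv ℝ ψ x (x - P x) - N * ψ x)) := by
    have i1n : Integrable fun x => -(fderiv ℝ hh x (gradient φ x) + hh x * lapl φ x) := i1.neg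
    rw [integral_add i1n (i2.const_mul k), integral_neg, z1, integral_const_mul]
    simpa using mul_nonneg hk0 z2
  have hres := setIntegral_eq_integral_of_forall_compl_eq_zero (μ := volume) (s := S)
    (f := fun x => (-(fderiv ℝ hh x (gradient φ x) + hh x * lapl φ x) +
      k * (- fderiv ℝ ψ x (x - P x) - N * ψ x))) fun x hx => by
      have a1 : fderiv ℝ ψ x = 0 := image_eq_zero_of_notMem_tsupport
        fun hc => hx (hψS (tsupport_fderiv_subset ℝ hc))
      simp [gradient_zero hx, hh0 x hx, hψ0 x hx, a1]
  rw [← hres] at key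
  have hJi : IntegrableOn (fun x => Hop K δ φ x * F (φ x) * Metric.infDist x K ^ (m + 2 - δ)
      - k * (N + m) * (Metric.infDist x K ^ m * G (φ x))
      + s ^ 2 * (Metric.infDist x K ^ m * (F (φ x) ^ 2 / F' (φ x)))) S := by
    refine ContinuousOn.integrableOn_compact hSc ?_
    have c1 := (h.continuousOn_Hop hKne hKcl δ hφ).mono hφs
    have c2 := fun e => (IsProj.continuousOn_rpow hKne hKcl e).mono hφs
    have c3 : ContinuousOn (fun x => F (φ x)) S := (hFc.comp hφ.continuous).continuousOn
    have c4 : ContinuousOn (fun x => G (φ x)) S := (hGc.comp hφ.continuous).continuousOn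
    have c5 : ContinuousOn (fun x => F' (φ x)) S := (hF'c.comp hφ.continuous).continuousOn
    exact (((c1.mul c3).mul (c2 _)).sub (continuousOn_const.mul ((c2 _).mul c4))).add
      (continuousOn_const.mul ((c2 _).mul ((c3.pow 2).div c5 fun x _ => (hF' _).ne')))
  refine ⟨hJi, key.trans (setIntegral_mono_on ?_ ?_ hScl.measurableSet ?_)⟩
  · exact (i1.neg.add (i2.const_mul k)).integrableOn
  · exact hJi
  · intro x hx
    have hρ := IsProj.pos hKne hKcl (hφs hx)
    have hdφ : HasFDerivAt φ (fderiv ℝ φ x) x := (hφ1.differentiable (by simp) x).hasFDerivAt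
    have dh : HasFDerivAt hh _ x := (h.hasFDerivAt_rpow (m + 2) hρ).mul
      ((hF (φ x)).comp_hasFDerivAt x hdφ)
    have dψ : HasFDerivAt ψ _ x := (h.hasFDerivAt_rpow m hρ).mul
      ((hG (φ x)).comp_hasFDerivAt x hdφ)
    rw [dh.fderiv, dψ.fderiv, h.Hop_eq δ φ hρ]
    simp only [add_apply, smul_apply, smul_eq_mul, innerSL_apply_apply, inner_gradient,
      real_inner_self_eq_norm_sq, hh, ψ]
    rw [h.dist x]
    have hD : ⟪x - P x, gradient φ x⟫ ^ 2 ≤ Metric.infDist x K ^ 2 * ‖gradient φ x‖ ^ 2 := by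
      rw [← h.dist x, ← mul_pow]
      exact sq_le_sq' (neg_le_of_abs_le (abs_real_inner_le_norm _ _)) (real_inner_le_norm _ _)
    generalize ⟪x - P x, gradient φ x⟫ = D at *
    generalize ‖gradient φ x‖ ^ 2 = g2 at *
    generalize Metric.infDist x K = ρ at *
    have hf' := hF' (φ x)
    generalize F (φ x) = f at *
    generalize F' (φ x) = f' at *
    generalize G (φ x) = g at *
    generalize lapl φ x = L at *
    have hR : 0 < ρ ^ m := Real.rpow_pos_of_pos hρ _
    have r1 : ρ ^ (m + 2) = ρ ^ m * ρ ^ 2 := by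
      rw [Real.rpow_add hρ]; norm_num
    have r2 : ρ ^ (m + 2 - 2) = ρ ^ m := by congr 1; ring
    have r3 : ρ ^ δ * ρ ^ (m + 2 - δ) = ρ ^ m * ρ ^ 2 := by
      rw [← Real.rpow_add hρ, ← r1]; congr 1; ring
    have r4 : ρ ^ (δ - 2) * ρ ^ (m + 2 - δ) = ρ ^ m := by
      rw [← Real.rpow_add hρ]; congr 1; ring
    have r5 : ρ ^ (m - 2) * ρ ^ 2 = ρ ^ m := by
      rw [← Real.rpow_natCast, ← Real.rpow_add hρ]; congr 1; push_cast; ring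
    rw [r1, r2]
    have main : 0 ≤ ρ ^ m * (ρ ^ 2 * g2 * f' + 2 * s * D * f + s ^ 2 * (f ^ 2 / f')) := by
      refine mul_nonneg hR.le ?_
      have : (f' * D + s * f) ^ 2 / f' = D ^ 2 * f' + 2 * s * D * f + s ^ 2 * (f ^ 2 / f') := by
        field_simp; ring
      have h2 : 0 ≤ (f' * D + s * f) ^ 2 / f' := by positivity
      nlinarith
    have e1 : (-(ρ ^ δ) * L - δ * ρ ^ (δ - 2) * D) * f * ρ ^ (m + 2 - δ)
        = - (ρ ^ m * ρ ^ 2) * L * f - δ * ρ ^ m * D * f := by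
      rw [← r3, ← r4]; ring
    have e2 : m * ρ ^ (m - 2) * ρ ^ 2 = m * ρ ^ m := by rw [mul_assoc, r5]
    rw [e1, e2]
    subst hk hm
    linear_combination main

end core


section reg
variable {p ε : ℝ}

def regF (p ε t : ℝ) : ℝ := t * (t ^ 2 + ε) ^ (p / 2 - 1)
def regF' (p ε t : ℝ) : ℝ := (t ^ 2 + ε) ^ (p / 2 - 2) * ((p - 1) * t ^ 2 + ε)
def regG (p ε t : ℝ) : ℝ := ((t ^ 2 + ε) ^ (p / 2) - ε ^ (p / 2)) / p

theorem regF_deriv (hε : 0 < ε) (t : ℝ) : HasDerivAt (regF p ε) (regF' p ε t) t := by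
  have hpos : 0 < t ^ 2 + ε := by positivity
  have h1 : HasDerivAt (fun t : ℝ => t ^ 2 + ε) (2 * t) t := by
    simpa using (hasDerivAt_pow 2 t).add_const ε
  have h2 := h1.rpow_const (p := p / 2 - 1) (Or.inl hpos.ne')
  have h3 := (hasDerivAt_id t).mul h2
  refine HasDerivAt.congr_deriv (f := regF p ε) h3 ?_
  have e : (t ^ 2 + ε) ^ (p / 2 - 1) = (t ^ 2 + ε) ^ (p / 2 - 2) * (t ^ 2 + ε) := by
    rw [← Real.rpow_add_one hpos.ne']; congr 1; ring
  have e' : (t ^ 2 + ε) ^ (p / 2 - 1 - 1) = (t ^ 2 + ε) ^ (p / 2 - 2) := by congr 1; ring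
  rw [e, e', regF']
  simp only [id]
  ring

theorem regG_deriv (hp : 1 < p) (hε : 0 < ε) (t : ℝ) :
    HasDerivAt (regG p ε) (regF p ε t) t := by
  have hpos : 0 < t ^ 2 + ε := by positivity
  have h1 : HasDerivAt (fun t : ℝ => t ^ 2 + ε) (2 * t) t := by
    simpa using (hasDerivAt_pow 2 t).add_const ε
  have h2 := ((h1.rpow_const (p := p / 2) (Or.inl hpos.ne')).sub_const (ε ^ (p / 2))).div_const p
  refine HasDerivAt.congr_deriv (f := regG p ε) h2 ?_
  rw [regF]
  field_simp

theorem regF'_cont (hε : 0 < ε) : Continuous (regF' p ε) := by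
  unfold regF'
  refine Continuous.mul (Continuous.rpow_const (by fun_prop) fun t => Or.inl ?_) (by fun_prop)
  positivity

theorem regF'_pos (hp : 1 < p) (hε : 0 < ε) (t : ℝ) : 0 < regF' p ε t := by
  have : 0 < p - 1 := by linarith
  unfold regF'; positivity

theorem regG_nonneg (hp : 1 < p) (hε : 0 < ε) (t : ℝ) : 0 ≤ regG p ε t := by
  unfold regG
  refine div_nonneg (sub_nonneg.2 ?_) (by linarith)
  exact Real.rpow_le_rpow hε.le (by nlinarith [sq_nonneg t]) (by linarith)

theorem regQ_eq (hε : 0 < ε) (t : ℝ) : regF p ε t ^ 2 / regF' p ε t =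
    (t ^ 2 + ε) ^ (p / 2) * (t ^ 2 / ((p - 1) * t ^ 2 + ε)) := by
  have hpos : 0 < t ^ 2 + ε := by positivity
  have e : ((t ^ 2 + ε) ^ (p / 2 - 1)) ^ 2 = (t ^ 2 + ε) ^ (p / 2 - 2) * (t ^ 2 + ε) ^ (p / 2) := by
    rw [← Real.rpow_natCast, ← Real.rpow_mul hpos.le, ← Real.rpow_add hpos]
    congr 1; push_cast; ring
  have h0 : (t ^ 2 + ε) ^ (p / 2 - 2) ≠ 0 := (Real.rpow_pos_of_pos hpos _).ne'
  rw [regF, regF', mul_pow, e, mul_left_comm, mul_div_mul_left _ _ h0]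
  ring

theorem reg_bounds (hp : 1 < p) (hε : 0 < ε) (hε1 : ε ≤ 1) {t M : ℝ} (ht : |t| ≤ M) :
    |regF p ε t| ≤ (M ^ 2 + 1) ^ ((p - 1) / 2) ∧ |regG p ε t| ≤ (M ^ 2 + 1) ^ (p / 2) ∧
    |regF p ε t ^ 2 / regF' p ε t| ≤ (M ^ 2 + 1) ^ (p / 2) / (p - 1) := by
  have hpos : 0 < t ^ 2 + ε := by positivity
  have hp1 : 0 < p - 1 := by linarith
  have ht2 : t ^ 2 ≤ M ^ 2 := sq_le_sq' (neg_le_of_abs_le ht) (le_of_abs_le ht)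
  have hle : t ^ 2 + ε ≤ M ^ 2 + 1 := by linarith
  have hpw : (t ^ 2 + ε) ^ (p / 2) ≤ (M ^ 2 + 1) ^ (p / 2) :=
    Real.rpow_le_rpow hpos.le hle (by linarith)
  refine ⟨?_, ?_, ?_⟩
  · have h1 : |t| ≤ (t ^ 2 + ε) ^ (1 / 2 : ℝ) := by
      rw [← Real.sqrt_eq_rpow]
      exact Real.abs_le_sqrt (by linarith)
    have h2 : (t ^ 2 + ε) ^ ((p - 1) / 2) = (t ^ 2 + ε) ^ (1 / 2 : ℝ) *
        (t ^ 2 + ε) ^ (p / 2 - 1) := by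
      rw [← Real.rpow_add hpos]; congr 1; ring
    have h3 : 0 < (t ^ 2 + ε) ^ (p / 2 - 1) := Real.rpow_pos_of_pos hpos _
    rw [regF, abs_mul, abs_of_pos h3]
    calc _ ≤ (t ^ 2 + ε) ^ ((p - 1) / 2) := by
          rw [h2]; exact mul_le_mul_of_nonneg_right h1 h3.le
      _ ≤ _ := Real.rpow_le_rpow hpos.le hle (by linarith)
  · rw [abs_of_nonneg (regG_nonneg hp hε t), regG]
    have h4 : 0 < ε ^ (p / 2) := Real.rpow_pos_of_pos hε _
    have h5 : 0 < (t ^ 2 + ε) ^ (p / 2) := Real.rpow_pos_of_pos hpos _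
    rw [div_le_iff₀ (by linarith)]
    nlinarith
  · rw [regQ_eq hε]
    have h5 : 0 < (t ^ 2 + ε) ^ (p / 2) := Real.rpow_pos_of_pos hpos _
    have h6 : t ^ 2 / ((p - 1) * t ^ 2 + ε) ≤ 1 / (p - 1) := by
      rw [div_le_div_iff₀ (by positivity) hp1]
      linarith
    have h7 : 0 ≤ t ^ 2 / ((p - 1) * t ^ 2 + ε) := by positivity
    rw [abs_of_nonneg (by positivity), div_eq_mul_one_div ((M ^ 2 + 1) ^ (p / 2))]
    exact mul_le_mul hpw h6 h7 (h5.le.trans hpw)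

theorem abs_rpow_eq (t e : ℝ) : (t ^ 2) ^ (e / 2) = |t| ^ e := by
  rw [← sq_abs, ← Real.rpow_natCast, ← Real.rpow_mul (abs_nonneg t)]
  congr 1; push_cast; ring

theorem regF_zero (p ε : ℝ) : regF p ε 0 = 0 := by simp [regF]
theorem regG_zero (p ε : ℝ) : regG p ε 0 = 0 := by simp [regG]

theorem reg_limits (hp : 1 < p) (t : ℝ) {e : ℕ → ℝ} (he : Filter.Tendsto e Filter.atTop (nhds 0))
    (hpos : ∀ n, 0 < e n) :
    Filter.Tendsto (fun n => regF p (e n) t) Filter.atTop (nhds (t * (t ^ 2) ^ (p / 2 - 1))) ∧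
    Filter.Tendsto (fun n => regG p (e n) t) Filter.atTop (nhds (|t| ^ p / p)) ∧
    Filter.Tendsto (fun n => regF p (e n) t ^ 2 / regF' p (e n) t) Filter.atTop
      (nhds (|t| ^ p / (p - 1))) := by
  have hp1 : 0 < p - 1 := by linarith
  by_cases ht : t = 0
  · subst ht
    have : p ≠ 0 := by linarith
    simp only [regF_zero, regG_zero]
    simp [Real.zero_rpow this]
  have ht2 : 0 < t ^ 2 := by positivity
  have h1 : Filter.Tendsto (fun n => t ^ 2 + e n) Filter.atTop (nhds (t ^ 2)) := by
    simpa using he.const_add (t ^ 2)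
  have h2 := fun q : ℝ => h1.rpow_const (p := q) (Or.inl ht2.ne')
  refine ⟨(h2 _).const_mul t, ?_, ?_⟩
  · have h3 := he.rpow_const (p := p / 2) (Or.inr (by linarith))
    have := ((h2 (p / 2)).sub h3).div_const p
    rw [Real.zero_rpow (by linarith), sub_zero, abs_rpow_eq] at this
    exact this
  · simp only [regQ_eq (hpos _)]
    have h4 : Filter.Tendsto (fun n => (p - 1) * t ^ 2 + e n) Filter.atTop
        (nhds ((p - 1) * t ^ 2)) := by simpa using he.const_add ((p - 1) * t ^ 2)
    have h5 : Filter.Tendsto (fun n => t ^ 2 / ((p - 1) * t ^ 2 + e n)) Filter.atTop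
        (nhds (t ^ 2 / ((p - 1) * t ^ 2))) :=
      tendsto_const_nhds.div h4 (by positivity)
    have := (h2 (p / 2)).mul h5
    rw [abs_rpow_eq] at this
    have e1 : |t| ^ p / (p - 1) = |t| ^ p * (t ^ 2 / ((p - 1) * t ^ 2)) := by field_simp
    rw [e1]
    exact this

theorem young_pt (hp : 1 < p) {C a t ρ m δ : ℝ} (hC : 0 < C) (hρ : 0 < ρ)
    (hm : m = (δ - 2) * p) :
    C ^ (p - 1) * (a * (t * (t ^ 2) ^ (p / 2 - 1)) * ρ ^ (m + 2 - δ) - C * (ρ ^ m * |t| ^ p)) ≤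
      (|a| ^ p - C ^ p * (ρ ^ m * |t| ^ p)) / p := by
  have hp1 : 0 < p - 1 := by linarith
  have hp0 : 0 < p := by linarith
  have hpq : p.HolderConjugate (p / (p - 1)) := Real.HolderConjugate.conjExponent hp
  have hy := Real.young_inequality a (C ^ (p - 1) * ((t * (t ^ 2) ^ (p / 2 - 1)) *
    ρ ^ (m + 2 - δ))) hpq
  have hCC : C ^ p = C ^ (p - 1) * C := by
    rw [← Real.rpow_add_one hC.ne']; congr 1; ring
  have ha : |t * (t ^ 2) ^ (p / 2 - 1)| = |t| ^ (p - 1) := by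
    by_cases ht : t = 0
    · subst ht; simp [Real.zero_rpow hp1.ne']
    have htp : 0 < |t| := abs_pos.2 ht
    have : p / 2 - 1 = (p - 2) / 2 := by ring
    rw [this, abs_rpow_eq, abs_mul, abs_of_pos (Real.rpow_pos_of_pos htp _), mul_comm,
      ← Real.rpow_add_one htp.ne']
    congr 1; ring
  have hb : |C ^ (p - 1) * ((t * (t ^ 2) ^ (p / 2 - 1)) * ρ ^ (m + 2 - δ))| ^ (p / (p - 1))
      = C ^ p * (ρ ^ m * |t| ^ p) := by
    have e1 : ρ ^ (m + 2 - δ) = (ρ ^ (δ - 2)) ^ (p - 1) := by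
      rw [← Real.rpow_mul hρ.le]; congr 1; rw [hm]; ring
    have e2 : ρ ^ m = (ρ ^ (δ - 2)) ^ p := by
      rw [← Real.rpow_mul hρ.le, hm]
    have hr : 0 < ρ ^ (δ - 2) := Real.rpow_pos_of_pos hρ _
    have e3 : (p - 1) * (p / (p - 1)) = p := by field_simp
    rw [abs_mul, abs_mul, ha, e1, e2, abs_of_pos (Real.rpow_pos_of_pos hC _),
      abs_of_pos (Real.rpow_pos_of_pos hr _),
      Real.mul_rpow (by positivity) (by positivity), Real.mul_rpow (by positivity) (by positivity),
      ← Real.rpow_mul hC.le, ← Real.rpow_mul hr.le, ← Real.rpow_mul (abs_nonneg t), e3]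
    ring
  rw [hb] at hy
  have hz : C ^ p * (ρ ^ m * |t| ^ p) / (p / (p - 1)) =
      C ^ p * (ρ ^ m * |t| ^ p) - C ^ p * (ρ ^ m * |t| ^ p) / p := by field_simp
  rw [hz] at hy
  rw [sub_div]
  have e1 : C ^ (p - 1) * (a * (t * (t ^ 2) ^ (p / 2 - 1)) * ρ ^ (m + 2 - δ)
      - C * (ρ ^ m * |t| ^ p)) = a * (C ^ (p - 1) * ((t * (t ^ 2) ^ (p / 2 - 1)) *
    ρ ^ (m + 2 - δ))) - C ^ p * (ρ ^ m * |t| ^ p) := by rw [hCC]; ring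
  rw [e1]
  linarith

end reg

/-- Weighted Rellich inequality with weight `d_Γ^δ` (the case `δ = δ'` of Theorem 1.2),
with the explicit optimal constant `C_p`. -/
theorem rellich_inequality_weight_dist_pow
    (d : ℕ) (hd : 1 ≤ d) (K : Set (EuclideanSpace ℝ (Fin d)))
    (hKne : K.Nonempty) (hKcl : IsClosed K) (hKconv : Convex ℝ K)
    (hKproper : K ≠ Set.univ)
    (dH : ℕ) (hdH : dH = min (Module.finrank ℝ (affineSpan ℝ K).direction) (d - 1))
    (p δ : ℝ) (hp : 1 < p) (hδ0 : 0 ≤ δ) (hδ2 : δ < 2)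
    (hcond : 0 < (d : ℝ) - dH + p * δ - 2 * p)
    (φ : EuclideanSpace ℝ (Fin d) → ℝ) (hφ : ContDiff ℝ 2 φ)
    (hφc : HasCompactSupport φ) (hφs : tsupport φ ⊆ Kᶜ) :
    (∫ x in Kᶜ, |Hop K δ φ x| ^ p)
      ≥ ((p - 1) * ((d : ℝ) - dH) * ((d : ℝ) - dH + p * δ - 2 * p) / p ^ 2) ^ p *
          ∫ x in Kᶜ, Metric.infDist x K ^ ((δ - 2) * p) * |φ x| ^ p := by
  obtain ⟨P, h⟩ := exists_isProj hKne hKcl hKconv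
  set N : ℝ := (d : ℝ) - dH with hNdef
  set m : ℝ := (δ - 2) * p with hm
  have hp1 : 0 < p - 1 := by linarith
  have hp0 : 0 < p := by linarith
  have hA : 0 < N + m := by rw [hm]; linarith
  have hN0 : 0 < N := by
    have : m ≤ 0 := mul_nonpos_of_nonpos_of_nonneg (by linarith) hp0.le
    linarith
  have hN : N = (d : ℝ) -
      ((min (Module.finrank ℝ (affineSpan ℝ K).direction) (d - 1) : ℕ) : ℝ) := by
    rw [hNdef, hdH]
  set s : ℝ := (N + m) * (p - 1) / p with hs
  have hs0 : 0 ≤ s := by positivity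
  set k : ℝ := 2 * s + (2 - δ) * (p - 1) with hk
  have hk0 : 0 ≤ k := by
    have : 0 ≤ 2 - δ := by linarith
    positivity
  set C : ℝ := (p - 1) * N * (N + p * δ - 2 * p) / p ^ 2 with hC
  have hCpos : 0 < C := by positivity
  have hCeq : k * (N + m) / p - s ^ 2 / (p - 1) = C := by
    rw [hC, hk, hs, hm]
    field_simp
    ring
  set S := tsupport φ with hS
  have hScl : IsClosed S := isClosed_tsupport φ
  have hSc : IsCompact S := hφc
  have hφ0 : ∀ x ∉ S, φ x = 0 := fun x hx => image_eq_zero_of_notMem_tsupport hx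
  have c1 := (h.continuousOn_Hop hKne hKcl δ hφ).mono hφs
  have c2 := fun e => (IsProj.continuousOn_rpow hKne hKcl e).mono hφs
  obtain ⟨M, hM⟩ := hSc.exists_bound_of_continuousOn hφ.continuous.continuousOn
  obtain ⟨B1, hB1⟩ := hSc.exists_bound_of_continuousOn c1
  obtain ⟨B2, hB2⟩ := hSc.exists_bound_of_continuousOn (c2 (m + 2 - δ))
  obtain ⟨B3, hB3⟩ := hSc.exists_bound_of_continuousOn (c2 m)
  let e : ℕ → ℝ := fun n => 1 / ((n : ℝ) + 1)
  have he0 : ∀ n, 0 < e n := fun n => by positivity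
  have he1 : ∀ n, e n ≤ 1 := fun n => by
    rw [div_le_one (by positivity)]; linarith [(Nat.cast_nonneg n : (0 : ℝ) ≤ n)]
  have het : Filter.Tendsto e Filter.atTop (nhds 0) := tendsto_one_div_add_atTop_nhds_zero_nat
  let J : ℕ → EuclideanSpace ℝ (Fin d) → ℝ := fun n x =>
    Hop K δ φ x * regF p (e n) (φ x) * Metric.infDist x K ^ (m + 2 - δ)
      - k * (N + m) * (Metric.infDist x K ^ m * regG p (e n) (φ x))
      + s ^ 2 * (Metric.infDist x K ^ m * (regF p (e n) (φ x) ^ 2 / regF' p (e n) (φ x)))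
  let J0 : EuclideanSpace ℝ (Fin d) → ℝ := fun x =>
    Hop K δ φ x * (φ x * (φ x ^ 2) ^ (p / 2 - 1)) * Metric.infDist x K ^ (m + 2 - δ)
      - C * (Metric.infDist x K ^ m * |φ x| ^ p)
  have hJ : ∀ n, IntegrableOn (J n) S ∧ 0 ≤ ∫ x in S, J n x := fun n =>
    core_ineq h hd hKne hKcl hN hm hk hk0 hφ hφc hφs (regF_deriv (he0 n))
      (regG_deriv hp (he0 n)) (regF'_cont (he0 n)) (regF_zero _ _) (regG_zero _ _)
      (regG_nonneg hp (he0 n)) (regF'_pos hp (he0 n))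
  have hlim : ∀ x, Filter.Tendsto (fun n => J n x) Filter.atTop (nhds (J0 x)) := by
    intro x
    obtain ⟨l1, l2, l3⟩ := reg_limits hp (φ x) het he0
    have := (((l1.const_mul (Hop K δ φ x)).mul_const (Metric.infDist x K ^ (m + 2 - δ))).sub
      ((l2.const_mul (Metric.infDist x K ^ m)).const_mul (k * (N + m)))).add
      ((l3.const_mul (Metric.infDist x K ^ m)).const_mul (s ^ 2))
    convert this using 2
    simp only [J0]
    rw [← hCeq]
    ring
  let B : ℝ := B1 * (M ^ 2 + 1) ^ ((p - 1) / 2) * B2 + k * (N + m) * (B3 * (M ^ 2 + 1) ^ (p / 2))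
    + s ^ 2 * (B3 * ((M ^ 2 + 1) ^ (p / 2) / (p - 1)))
  have hbd : ∀ n, ∀ x ∈ S, ‖J n x‖ ≤ B := by
    intro n x hx
    obtain ⟨b1, b2, b3⟩ := reg_bounds hp (he0 n) (he1 n) (hM x hx)
    have a1 := hB1 x hx
    have a2 := hB2 x hx
    have a3 := hB3 x hx
    rw [Real.norm_eq_abs] at *
    have hB1n : 0 ≤ B1 := (abs_nonneg _).trans a1
    have hB3n : 0 ≤ B3 := (abs_nonneg _).trans a3
    refine (abs_add_le _ _).trans (add_le_add ((abs_sub _ _).trans (add_le_add ?_ ?_)) ?_)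
    · rw [abs_mul, abs_mul]
      gcongr
    · rw [abs_mul, abs_mul (_ ^ m), abs_of_nonneg (mul_nonneg hk0 hA.le)]
      gcongr
    · rw [abs_mul, abs_mul (_ ^ m), abs_of_nonneg (sq_nonneg s)]
      gcongr
  have hfin : volume S ≠ ⊤ := hSc.measure_lt_top.ne
  have hBint : IntegrableOn (fun _ : EuclideanSpace ℝ (Fin d) => B) S :=
    integrableOn_const hfin
  have hmeas : ∀ n, AEStronglyMeasurable (J n) (volume.restrict S) :=
    fun n => (hJ n).1.aestronglyMeasurable
  have hJ0 : 0 ≤ ∫ x in S, J0 x := by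
    have ht := tendsto_integral_of_dominated_convergence (μ := volume.restrict S)
      (F := J) (f := J0) (fun _ => B) hmeas hBint
      (fun n => (ae_restrict_mem hScl.measurableSet).mono fun x hx => hbd n x hx)
      (Filter.Eventually.of_forall hlim)
    exact ge_of_tendsto' ht fun n => (hJ n).2
  have hJ0i : IntegrableOn J0 S := by
    refine Integrable.mono' hBint (aestronglyMeasurable_of_tendsto_ae Filter.atTop hmeas
      (Filter.Eventually.of_forall hlim)) ?_
    refine (ae_restrict_mem hScl.measurableSet).mono fun x hx => ?_
    exact le_of_tendsto' (hlim x).norm fun n => hbd n x hx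
  have i1 : IntegrableOn (fun x => |Hop K δ φ x| ^ p) S :=
    ContinuousOn.integrableOn_compact hSc (c1.abs.rpow_const fun x _ => Or.inr hp0.le)
  have i2 : IntegrableOn (fun x => Metric.infDist x K ^ m * |φ x| ^ p) S :=
    ContinuousOn.integrableOn_compact hSc ((c2 m).mul
      (hφ.continuous.continuousOn.abs.rpow_const fun x _ => Or.inr hp0.le))
  have hfinal : 0 ≤ ∫ x in S, (|Hop K δ φ x| ^ p -
      C ^ p * (Metric.infDist x K ^ m * |φ x| ^ p)) / p := by
    have h1 : 0 ≤ ∫ x in S, C ^ (p - 1) * J0 x := by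
      rw [integral_const_mul]
      positivity
    refine h1.trans (setIntegral_mono_on (hJ0i.const_mul _)
      ((i1.sub (i2.const_mul _)).div_const p) hScl.measurableSet fun x hx => ?_)
    exact young_pt hp hCpos (IsProj.pos hKne hKcl (hφs hx)) hm
  rw [integral_div, integral_sub i1 (i2.const_mul _), integral_const_mul] at hfinal
  have hfin2 := mul_nonneg hfinal hp0.le
  rw [div_mul_cancel₀ _ hp0.ne'] at hfin2
  have E1 : ∫ x in Kᶜ, |Hop K δ φ x| ^ p = ∫ x in S, |Hop K δ φ x| ^ p :=
    setIntegral_eq_of_subset_of_forall_diff_eq_zero hKcl.isOpen_compl.measurableSet hφs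
      fun x hx => by rw [Hop_zero hx.2, abs_zero, Real.zero_rpow hp0.ne']
  have E2 : ∫ x in Kᶜ, Metric.infDist x K ^ m * |φ x| ^ p =
      ∫ x in S, Metric.infDist x K ^ m * |φ x| ^ p :=
    setIntegral_eq_of_subset_of_forall_diff_eq_zero hKcl.isOpen_compl.measurableSet hφs
      fun x hx => by rw [hφ0 x hx.2, abs_zero, Real.zero_rpow hp0.ne', mul_zero]
  rw [E1, E2]
  linarith
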